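/- Let A ∈ L(H) be invertible and let S, T ∈ Sym(H) ∩ HS(H) be such that (I−S)^{-1} = A*A and I−T = AA*. Then ‖S‖_HS = ‖T(I−T)^{-1}‖_HS, ‖T‖_HS = ‖S(I−S)^{-1}‖_HS, and tr[S²(I−S)^{-1}] = ‖S(I−S)^{-1/2}‖²_HS = ‖T(I−T)^{-1/2}‖²_HS = tr[T²(I−T)^{-1}]. -/

import Mathlib

open scoped RealInnerProductSpace
open ContinuousLinearMap

noncomputable section

variable {H : Type*} [NormedAddCommGroup H] [InnerProductSpace ℝ H] [CompleteSpace H]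

/-- `A` is positive definite: self-adjoint and `⟪x, A x⟫ ≥ M‖x‖²` for some `M > 0`. -/
def IsPosDef (A : H →L[ℝ] H) : Prop :=
  IsSelfAdjoint A ∧ ∃ M : ℝ, 0 < M ∧ ∀ x : H, M * ‖x‖ ^ 2 ≤ ⟪x, A x⟫

/-- `A` is Hilbert-Schmidt (with respect to the Hilbert basis `e`; this is
basis-independent). -/
def IsHS (e : HilbertBasis ℕ ℝ H) (A : H →L[ℝ] H) : Prop :=
  Summable fun n => ‖A (e n)‖ ^ 2

/-- The trace of `A` computed along the Hilbert basis `e` (basis-independent for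
trace-class operators). -/
def traceAlong (e : HilbertBasis ℕ ℝ H) (A : H →L[ℝ] H) : ℝ :=
  ∑' n, ⟪e n, A (e n)⟫

/-- The Hilbert-Schmidt norm of `A`, computed along the Hilbert basis `e`
(basis-independent). -/
def hsNorm (e : HilbertBasis ℕ ℝ H) (A : H →L[ℝ] H) : ℝ :=
  Real.sqrt (∑' n, ‖A (e n)‖ ^ 2)

section IncompleteSpace

variable {E : Type*} [NormedAddCommGroup E] [InnerProductSpace ℝ E]
  {e : HilbertBasis ℕ ℝ E} {P Q : E →L[ℝ] E}

theorem HilbertBasis.hasSum_inner_sq (e : HilbertBasis ℕ ℝ E) (x : E) :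
    HasSum (fun n => ⟪e n, x⟫ ^ 2) (‖x‖ ^ 2) := by
  simpa only [real_inner_comm, ← pow_two, real_inner_self_eq_norm_sq]
    using e.hasSum_inner_mul_inner x x

theorem IsHS.summable_inner_sq (hP : IsHS e P) :
    Summable fun p : ℕ × ℕ => ⟪e p.2, P (e p.1)⟫ ^ 2 := by
  refine (summable_prod_of_nonneg fun _ => sq_nonneg _).2
    ⟨fun n => (e.hasSum_inner_sq (P (e n))).summable, ?_⟩
  exact hP.congr fun n => (e.hasSum_inner_sq (P (e n))).tsum_eq.symm

theorem IsHS.neg (hP : IsHS e P) : IsHS e (-P) := by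
  simpa [IsHS] using hP

theorem IsHS.add (hP : IsHS e P) (hQ : IsHS e Q) : IsHS e (P + Q) := by
  refine Summable.of_nonneg_of_le (fun _ => sq_nonneg _) (fun n => ?_)
    ((Summable.add hP hQ).mul_left 2)
  calc ‖(P + Q) (e n)‖ ^ 2 ≤ (‖P (e n)‖ + ‖Q (e n)‖) ^ 2 := by
        gcongr
        exact norm_add_le _ _
    _ ≤ 2 * (‖P (e n)‖ ^ 2 + ‖Q (e n)‖ ^ 2) := add_sq_le

theorem IsHS.sub (hP : IsHS e P) (hQ : IsHS e Q) : IsHS e (P - Q) := by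
  simpa only [sub_eq_add_neg] using hP.add hQ.neg

theorem IsHS.mul_left (B : E →L[ℝ] E) (hP : IsHS e P) : IsHS e (B * P) := by
  refine Summable.of_nonneg_of_le (fun _ => sq_nonneg _) (fun n => ?_)
    (Summable.mul_left (‖B‖ ^ 2) hP)
  rw [← mul_pow]
  gcongr
  exact B.le_opNorm _

end IncompleteSpace

section HilbertSchmidt

variable {e : HilbertBasis ℕ ℝ H} {P Q : H →L[ℝ] H}

theorem tsum_inner_sq_comm (e : HilbertBasis ℕ ℝ H) (P : H →L[ℝ] H) (m : ℕ) :
    ∑' n, ⟪e m, P (e n)⟫ ^ 2 = ‖adjoint P (e m)‖ ^ 2 := by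
  rw [← (e.hasSum_inner_sq (adjoint P (e m))).tsum_eq]
  simp only [adjoint_inner_right, real_inner_comm]

theorem IsHS.adjoint (hP : IsHS e P) : IsHS e (adjoint P) := by
  refine hP.summable_inner_sq.prod_symm.prod.congr fun m => ?_
  exact tsum_inner_sq_comm e P m

theorem IsHS.tsum_norm_sq_adjoint (hP : IsHS e P) :
    ∑' n, ‖ContinuousLinearMap.adjoint P (e n)‖ ^ 2 = ∑' n, ‖P (e n)‖ ^ 2 := by
  simp only [← tsum_inner_sq_comm, ← (e.hasSum_inner_sq (P (e _))).tsum_eq]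
  exact Summable.tsum_comm (f := fun n m => ⟪e m, P (e n)⟫ ^ 2) hP.summable_inner_sq

theorem IsHS.mul_right (hP : IsHS e P) (B : H →L[ℝ] H) : IsHS e (P * B) := by
  simpa [← star_eq_adjoint] using (hP.adjoint.mul_left (ContinuousLinearMap.adjoint B)).adjoint

theorem traceAlong_adjoint_mul_self (e : HilbertBasis ℕ ℝ H) (P : H →L[ℝ] H) :
    traceAlong e (adjoint P * P) = ∑' n, ‖P (e n)‖ ^ 2 := by
  simp [traceAlong, adjoint_inner_right]

theorem hsNorm_eq_sqrt_traceAlong (e : HilbertBasis ℕ ℝ H) (P : H →L[ℝ] H) :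
    hsNorm e P = √(traceAlong e (adjoint P * P)) := by
  rw [traceAlong_adjoint_mul_self, hsNorm]

theorem hsNorm_sq (e : HilbertBasis ℕ ℝ H) (P : H →L[ℝ] H) :
    hsNorm e P ^ 2 = traceAlong e (adjoint P * P) := by
  rw [traceAlong_adjoint_mul_self, hsNorm, Real.sq_sqrt (tsum_nonneg fun _ => sq_nonneg _)]

theorem IsHS.four_mul_traceAlong_mul (hP : IsHS e P) (hQ : IsHS e Q) :
    4 * traceAlong e (P * Q) =
      ∑' n, ‖(ContinuousLinearMap.adjoint P + Q) (e n)‖ ^ 2 -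
        ∑' n, ‖(ContinuousLinearMap.adjoint P - Q) (e n)‖ ^ 2 := by
  rw [← Summable.tsum_sub (hP.adjoint.add hQ) (hP.adjoint.sub hQ), traceAlong, ← tsum_mul_left]
  refine tsum_congr fun n => ?_
  rw [add_apply, sub_apply, norm_add_sq_real, norm_sub_sq_real, adjoint_inner_left]
  change 4 * ⟪e n, P (Q (e n))⟫ = _
  ring

theorem IsHS.traceAlong_mul_comm (hP : IsHS e P) (hQ : IsHS e Q) :
    traceAlong e (P * Q) = traceAlong e (Q * P) := by
  have h := hP.four_mul_traceAlong_mul hQ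
  rw [← (hP.adjoint.add hQ).tsum_norm_sq_adjoint, ← (hP.adjoint.sub hQ).tsum_norm_sq_adjoint,
    map_add, map_sub, adjoint_adjoint, add_comm P] at h
  have h' := hQ.four_mul_traceAlong_mul hP
  have hsub : ∀ n, ‖(P - ContinuousLinearMap.adjoint Q) (e n)‖ =
      ‖(ContinuousLinearMap.adjoint Q - P) (e n)‖ := fun n => by
    rw [sub_apply, sub_apply, norm_sub_rev]
  simp only [hsub] at h
  linarith

theorem IsHS.traceAlong_conj (hP : IsHS e P) (hQ : IsHS e Q) {A B : H →L[ℝ] H}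
    (hBA : B * A = 1) : traceAlong e (A * P * (Q * B)) = traceAlong e (P * Q) := by
  rw [(hP.mul_left A).traceAlong_mul_comm (hQ.mul_right B), mul_assoc Q B,
    ← mul_assoc B A, hBA, one_mul, hQ.traceAlong_mul_comm hP]

theorem IsHS.hsNorm_mul_sq (hP : IsHS e P) (hPsa : IsSelfAdjoint P) {R : H →L[ℝ] H}
    (hR : IsSelfAdjoint R) (hcomm : Commute P (R * R)) :
    hsNorm e (P * R) ^ 2 = traceAlong e (P * P * (R * R)) := by
  rw [hsNorm_sq, ← star_eq_adjoint, star_mul, hPsa.star_eq, hR.star_eq,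
    (hP.mul_left R).traceAlong_mul_comm (hP.mul_right R), mul_assoc P R, ← mul_assoc R R P,
    ← hcomm.eq, mul_assoc]

end HilbertSchmidt

/-- if `A` is invertible, `S, T ∈ Sym(H) ∩ HS(H)` with
`(I-S)⁻¹ = A*A` (= NS) and `I-T = AA*` (with inverse NT), then
`‖S‖_HS = ‖T(I-T)⁻¹‖_HS`, `‖T‖_HS = ‖S(I-S)⁻¹‖_HS`, and
`tr[S²(I-S)⁻¹] = ‖S(I-S)^{-1/2}‖²_HS = ‖T(I-T)^{-1/2}‖²_HS = tr[T²(I-T)⁻¹]`,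
where `RS = (I-S)^{-1/2}` and `RT = (I-T)^{-1/2}`. -/
theorem hsNorm_relations_of_polar_pair
    (e : HilbertBasis ℕ ℝ H)
    (A S T NS NT RS RT : H →L[ℝ] H)
    (hAunit : IsUnit A)
    (hSsa : IsSelfAdjoint S) (hSHS : IsHS e S)
    (hTsa : IsSelfAdjoint T) (hTHS : IsHS e T)
    (hNSdef : NS = adjoint A * A)
    (hNS₁ : (1 - S) * NS = 1) (hNS₂ : NS * (1 - S) = 1)
    (hTdef : 1 - T = A * adjoint A)
    (hNT₁ : (1 - T) * NT = 1) (hNT₂ : NT * (1 - T) = 1)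
    (hRSpos : RS.IsPositive) (hRSsq : RS * RS = NS)
    (hRTpos : RT.IsPositive) (hRTsq : RT * RT = NT) :
    hsNorm e S = hsNorm e (T * NT) ∧
    hsNorm e T = hsNorm e (S * NS) ∧
    traceAlong e (S * S * NS) = hsNorm e (S * RS) ^ 2 ∧
    hsNorm e (S * RS) = hsNorm e (T * RT) ∧
    traceAlong e (S * S * NS) = traceAlong e (T * T * NT) := by
  obtain ⟨u, rfl⟩ := hAunit
  set A : H →L[ℝ] H := u.val
  set B : H →L[ℝ] H := u⁻¹.val
  have hBA : B * A = 1 := u.inv_mul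
  have hAB : A * B = 1 := u.mul_inv
  have hRSsa := hRSpos.isSelfAdjoint
  have hRTsa := hRTpos.isSelfAdjoint
  have hNSsa : IsSelfAdjoint NS := by
    rw [← hRSsq, IsSelfAdjoint, star_mul, hRSsa.star_eq]
  have hNTsa : IsSelfAdjoint NT := by
    rw [← hRTsq, IsSelfAdjoint, star_mul, hRTsa.star_eq]
  have hSNS : S * NS = NS - 1 := by
    rw [sub_mul, one_mul] at hNS₁
    rw [← hNS₁]; abel
  have hNSS : NS * S = NS - 1 := by
    rw [mul_sub, mul_one] at hNS₂
    rw [← hNS₂]; abel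
  have hTNT : T * NT = NT - 1 := by
    rw [sub_mul, one_mul] at hNT₁
    rw [← hNT₁]; abel
  have hNTT : NT * T = NT - 1 := by
    rw [mul_sub, mul_one] at hNT₂
    rw [← hNT₂]; abel
  have hScomm : Commute S NS := hSNS.trans hNSS.symm
  have hTcomm : Commute T NT := hTNT.trans hNTT.symm
  have hTconj : T = -(A * (S * NS) * B) := by
    have h : T = 1 - A * adjoint A := by rw [← hTdef]; abel
    rw [hSNS, hNSdef, mul_sub, mul_one, sub_mul, hAB, mul_assoc A, mul_assoc (adjoint A), hAB,
      mul_one, h]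
    abel
  have hNTconj : NT = A * (1 - S) * B := by
    have h : (1 - T) * (A * (1 - S) * B) = 1 := by
      rw [hTdef, mul_assoc A (adjoint A), mul_assoc A (1 - S), ← mul_assoc (adjoint A) A,
        ← hNSdef, ← mul_assoc NS, hNS₂, one_mul, hAB]
    calc NT = NT * ((1 - T) * (A * (1 - S) * B)) := by rw [h, mul_one]
      _ = A * (1 - S) * B := by rw [← mul_assoc, hNT₂, one_mul]
  have hTNTconj : T * NT = -(A * S * B) := by
    rw [hTNT, hNTconj, mul_sub, mul_one, sub_mul, hAB]
    abel
  have hSNSHS : IsHS e (S * NS) := hSHS.mul_right NS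
  have hSNSsa : IsSelfAdjoint (S * NS) := hSNS ▸ hNSsa.sub (.one _)
  have hTNTsa : IsSelfAdjoint (T * NT) := hTNT ▸ hNTsa.sub (.one _)
  have hconj (P Q : H →L[ℝ] H) (hP : IsHS e P) (hQ : IsHS e Q) :
      traceAlong e (-(A * P * B) * -(A * Q * B)) = traceAlong e (P * Q) := by
    rw [neg_mul_neg, mul_assoc (A * P), mul_assoc A Q, ← mul_assoc B A, hBA, one_mul,
      hP.traceAlong_conj hQ hBA]
  have hS : traceAlong e (S * S * NS) = hsNorm e (S * RS) ^ 2 := by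
    rw [hSHS.hsNorm_mul_sq hSsa hRSsa (hRSsq ▸ hScomm), hRSsq]
  have hT : traceAlong e (T * T * NT) = hsNorm e (T * RT) ^ 2 := by
    rw [hTHS.hsNorm_mul_sq hTsa hRTsa (hRTsq ▸ hTcomm), hRTsq]
  have hST : traceAlong e (S * S * NS) = traceAlong e (T * T * NT) := by
    rw [mul_assoc T, hTNTconj, hTconj, hconj _ _ hSNSHS hSHS, mul_assoc S NS, ← hScomm.eq, mul_assoc]
  refine ⟨?_, ?_, hS, ?_, hST⟩
  · rw [hsNorm_eq_sqrt_traceAlong, hsNorm_eq_sqrt_traceAlong, hSsa.adjoint_eq, hTNTsa.adjoint_eq,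
      hTNTconj, hconj _ _ hSHS hSHS]
  · rw [hsNorm_eq_sqrt_traceAlong, hsNorm_eq_sqrt_traceAlong, hTsa.adjoint_eq, hSNSsa.adjoint_eq,
      hTconj, hconj _ _ hSNSHS hSNSHS]
  · rw [hS, hT] at hST
    exact (sq_eq_sq₀ (Real.sqrt_nonneg _) (Real.sqrt_nonneg _)).1 hST
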